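/- arXiv:2210.12821 — 3 statements merged into one kernel-verified Lean document; each statement's English description precedes it below -/
import Mathlib

section
/- Let q ≥ 5 be an odd prime power with q ≡ 1 (mod 3) such that 2 is not a cube in F_q. Then there is no β ∈ F_q for which the cubic polynomial t³ - 3βt² - 1 has exactly two roots in F_q, and the number of β ∈ F_q for which it has exactly one root in F_q equals the number of β ∈ F_q with η(1 + 4β³) = -1. -/
open scoped Classical

/-- The quadratic character of a field: `η a = 1` if `a` is a nonzero square,
`η a = -1` if `a` is a non-square, and `η 0 = 0`. -/
noncomputable def quadChar (F : Type*) [Field F] (a : F) : ℤ :=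
  if a = 0 then 0 else if IsSquare a then 1 else -1

theorem quadChar_eq_neg_one_iff {F : Type*} [Field F] {a : F} :
    quadChar F a = -1 ↔ ¬ IsSquare a := by
  unfold quadChar
  split_ifs with h0 h <;> simp_all

/-- Vieta: the third root of `t³ - 3βt² - 1` once two distinct roots are known. -/
theorem cubic_third_root {K : Type*} [Field K] {β a b : K} (hab : a ≠ b)
    (ha : a ^ 3 - 3 * β * a ^ 2 - 1 = 0) (hb : b ^ 3 - 3 * β * b ^ 2 - 1 = 0) :
    (3 * β - a - b) ^ 3 - 3 * β * (3 * β - a - b) ^ 2 - 1 = 0 := by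
  have h : a ^ 2 + a * b + b ^ 2 - 3 * β * (a + b) = 0 := by
    apply mul_left_cancel₀ (sub_ne_zero.mpr hab)
    linear_combination ha - hb
  linear_combination ha + (3 * β - a - b - a) * h

/-- The discriminant of `t³ - 3βt² - 1` as the discriminant of the quadratic cofactor of a root
times the square of the derivative there. -/
theorem cubic_discr_of_root {K : Type*} [Field K] {β r : K}
    (hr : r ^ 3 - 3 * β * r ^ 2 - 1 = 0) :
    -27 * (1 + 4 * β ^ 3) =
      ((r - 3 * β) ^ 2 - 4 * (r * (r - 3 * β))) * (3 * r ^ 2 - 6 * β * r) ^ 2 := by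
  linear_combination 27 * (1 + (r + β) * (r - 2 * β) ^ 2) * hr

/-- The discriminant of `t³ - 3βt² - 1` in terms of its roots. -/
theorem cubic_discr {K : Type*} [Field K] {β a b : K} (hab : a ≠ b)
    (ha : a ^ 3 - 3 * β * a ^ 2 - 1 = 0) (hb : b ^ 3 - 3 * β * b ^ 2 - 1 = 0) :
    ((a - b) * (b - (3 * β - a - b)) * ((3 * β - a - b) - a)) ^ 2 =
      -27 * (1 + 4 * β ^ 3) := by
  have h : a ^ 2 + a * b + b ^ 2 - 3 * β * (a + b) = 0 := by
    apply mul_left_cancel₀ (sub_ne_zero.mpr hab)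
    linear_combination ha - hb
  have hp : (a - b) * ((3 * β - a - b) - a) = -(3 * a ^ 2 - 6 * β * a) := by
    linear_combination h
  have hq : (b - (3 * β - a - b)) ^ 2 = (a - 3 * β) ^ 2 - 4 * (a * (a - 3 * β)) := by
    linear_combination 4 * h
  rw [cubic_discr_of_root ha, mul_right_comm, mul_pow, hp, hq]
  ring

theorem exists_sq_eq_neg_three {F : Type*} [Field F] [Fintype F]
    (hF : Fintype.card F % 3 = 1) : ∃ w : F, w ^ 2 = -3 := by
  have : Fact (Nat.Prime 3) := ⟨Nat.prime_three⟩
  have hd : 3 ∣ Fintype.card Fˣ := by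
    rw [Fintype.card_units]; omega
  obtain ⟨g, hg⟩ := exists_prime_orderOf_dvd_card 3 hd
  have h3 : (g : F) ^ 3 = 1 := by
    rw [← Units.val_pow_eq_pow_val, ← hg, pow_orderOf_eq_one, Units.val_one]
  have h1 : (g : F) - 1 ≠ 0 := by
    intro h
    have : g = 1 := Units.ext (by simpa using sub_eq_zero.mp h)
    simp [this] at hg
  have h : (g : F) ^ 2 + g + 1 = 0 := by
    apply mul_left_cancel₀ h1
    linear_combination h3
  exact ⟨2 * g + 1, by linear_combination 4 * h⟩

theorem three_ne_zero_of_card_mod {F : Type*} [Field F] [Fintype F]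
    (hF : Fintype.card F % 3 = 1) : (3 : F) ≠ 0 := by
  intro h
  have h0 := FiniteField.cast_card_eq_zero F
  rw [← Nat.div_add_mod (Fintype.card F) 3, hF] at h0
  push_cast at h0
  simp [h] at h0

/-- Elements of an extension fixed by the `#F`-power Frobenius lie in `F`. -/
theorem exists_algebraMap_eq_of_pow_card {F L : Type*} [Field F] [Fintype F] [Field L]
    [Algebra F L] {x : L} (hx : x ^ Fintype.card F = x) : ∃ y : F, algebraMap F L y = x := by
  have hsplit : (Polynomial.X ^ Fintype.card F - Polynomial.X : Polynomial F) =
      ∏ y : F, (Polynomial.X - Polynomial.C y) := by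
    have hdeg := FiniteField.X_pow_card_sub_X_natDegree_eq F (Fintype.one_lt_card (α := F))
    have hmonic : (Polynomial.X ^ Fintype.card F - Polynomial.X : Polynomial F).Monic :=
      Polynomial.monic_X_pow_sub (by
        rw [Polynomial.degree_X]
        exact_mod_cast Fintype.one_lt_card (α := F))
    have hroots := FiniteField.roots_X_pow_card_sub_X F
    have := Polynomial.prod_multiset_X_sub_C_of_monic_of_roots_card_eq hmonic
      (by rw [hroots, hdeg]; rfl)
    rw [← this, hroots]
    rfl
  have h := congrArg (Polynomial.aeval x) hsplit
  simp only [map_sub, map_pow, Polynomial.aeval_X, map_prod, Polynomial.aeval_C, hx, sub_self]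
    at h
  obtain ⟨y, -, hy⟩ := Finset.prod_eq_zero_iff.mp h.symm
  exact ⟨y, (sub_eq_zero.mp hy).symm⟩

/-- Over a finite field, a cubic `t³ - 3βt² - 1` without roots has square discriminant. -/
theorem exists_discr_eq_sq_of_no_root {F : Type*} [Field F] [Fintype F] {β : F}
    (h : ∀ t : F, t ^ 3 - 3 * β * t ^ 2 - 1 ≠ 0) : ∃ d : F, d ^ 2 = -27 * (1 + 4 * β ^ 3) := by
  let L := AlgebraicClosure F
  let B : L := algebraMap F L β
  let φ : L →ₐ[F] L := FiniteField.frobeniusAlgHom F L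
  have hfix {x : L} (hx : φ x = x) : ∃ y : F, algebraMap F L y = x :=
    exists_algebraMap_eq_of_pow_card hx
  have hno {x : L} (hx : x ^ 3 - 3 * B * x ^ 2 - 1 = 0) : φ x ≠ x := by
    intro hf
    obtain ⟨y, rfl⟩ := hfix hf
    apply h y
    apply (algebraMap F L).injective
    simpa [map_ofNat (algebraMap F L)] using hx
  have hB : φ B = B := φ.commutes β
  have hroot {x : L} (hx : x ^ 3 - 3 * B * x ^ 2 - 1 = 0) :
      φ x ^ 3 - 3 * B * φ x ^ 2 - 1 = 0 := by
    have := congrArg φ hx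
    simpa [map_ofNat φ, hB] using this
  obtain ⟨a, ha⟩ : ∃ a : L, a ^ 3 - 3 * B * a ^ 2 - 1 = 0 := by
    let p : Polynomial L := .X ^ 3 + .C (-3 * B) * .X ^ 2 + .C (-1)
    have hp : p.degree ≠ 0 := by
      have : p.degree = 3 := by simp only [p]; compute_degree!
      simp [this]
    obtain ⟨a, ha⟩ := IsAlgClosed.exists_root p hp
    refine ⟨a, ?_⟩
    simp only [p, Polynomial.IsRoot.def, Polynomial.eval_add, Polynomial.eval_pow,
      Polynomial.eval_mul, Polynomial.eval_C, Polynomial.eval_X] at ha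
    linear_combination ha
  have hb := hroot ha
  have hab : a ≠ φ a := (hno ha).symm
  have hc := cubic_third_root hab ha hb
  set b := φ a with hbdef
  have hca : φ b ≠ a := by
    intro hba
    apply hno hc
    simp only [map_sub, map_mul, hB, hba, ← hbdef, map_ofNat]
    ring
  have hφb : φ b = 3 * B - a - b := by
    have hbc : φ b ≠ b := hno hb
    have hr := hroot hb
    have e1 : φ b ^ 2 + φ b * b + b ^ 2 - 3 * B * (φ b + b) = 0 := by
      apply mul_left_cancel₀ (sub_ne_zero.mpr hbc)
      linear_combination hr - hb
    have e2 : a ^ 2 + a * b + b ^ 2 - 3 * B * (a + b) = 0 := by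
      apply mul_left_cancel₀ (sub_ne_zero.mpr hab)
      linear_combination ha - hb
    apply mul_left_cancel₀ (sub_ne_zero.mpr hca)
    linear_combination e1 - e2
  have hφc : φ (3 * B - a - b) = a := by
    simp only [map_sub, map_mul, hB, hφb, ← hbdef, map_ofNat]
    ring
  obtain ⟨d, hd⟩ : ∃ d : F, algebraMap F L d =
      (a - b) * (b - (3 * B - a - b)) * ((3 * B - a - b) - a) := by
    apply hfix
    rw [map_mul, map_mul, map_sub, map_sub φ b, map_sub φ _ a, hφc, hφb, ← hbdef]
    ring
  refine ⟨d, (algebraMap F L).injective ?_⟩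
  rw [map_pow, hd, cubic_discr hab ha hb]
  simp only [B, map_mul, map_add, map_neg, map_one, map_pow, map_ofNat]

/-- A root of `t³ - 3βt² - 1` is accompanied by a second one when the discriminant is a
nonzero square. -/
theorem exists_second_root {F : Type*} [Field F] {β r d : F} (h2 : (2 : F) ≠ 0) (hd0 : d ≠ 0)
    (hd : d ^ 2 = -27 * (1 + 4 * β ^ 3)) (hr : r ^ 3 - 3 * β * r ^ 2 - 1 = 0) :
    ∃ s, s ≠ r ∧ s ^ 3 - 3 * β * s ^ 2 - 1 = 0 := by
  have hD : d ^ 2 = ((r - 3 * β) ^ 2 - 4 * (r * (r - 3 * β))) * (3 * r ^ 2 - 6 * β * r) ^ 2 :=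
    hd.trans (cubic_discr_of_root hr)
  have hm : 3 * r ^ 2 - 6 * β * r ≠ 0 := by
    intro hm
    rw [hm] at hD
    apply hd0
    simpa using hD
  set m := 3 * r ^ 2 - 6 * β * r with hmdef
  obtain ⟨z, hz⟩ : ∃ z, z = d / m := ⟨_, rfl⟩
  have hzz : z ^ 2 = (r - 3 * β) ^ 2 - 4 * (r * (r - 3 * β)) := by
    rw [hz, div_pow, hD]
    field_simp
  obtain ⟨s, hs⟩ : ∃ s, s = (3 * β - r + z) / 2 := ⟨_, rfl⟩
  have hzs : z = 2 * s - 3 * β + r := by rw [hs]; field_simp; ring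
  have hq : s ^ 2 + (r - 3 * β) * s + r * (r - 3 * β) = 0 := by
    have h4 : (4 : F) ≠ 0 := by
      have : (4 : F) = 2 * 2 := by norm_num
      rw [this]; exact mul_ne_zero h2 h2
    apply mul_left_cancel₀ h4
    rw [hzs] at hzz
    linear_combination hzz
  refine ⟨s, ?_, by linear_combination hr + (s - r) * hq⟩
  rintro rfl
  apply hm
  linear_combination hq

/-- Let `q ≥ 5` be an odd prime power with `q ≡ 1 (mod 3)` such that `2` is
not a cube in `F_q`. Then there is no `β ∈ F_q` for which `t³ - 3βt² - 1` has exactly two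
roots in `F_q`, and the number of `β` for which it has exactly one root equals the number
of `β ∈ F_q` with `η(1 + 4β³) = -1`. -/
theorem stmt1 (q : ℕ) (hq5 : 5 ≤ q) (hodd : Odd q) (hq3 : q % 3 = 1)
    (F : Type*) [Field F] [Fintype F] (hcard : Fintype.card F = q)
    (h2 : ¬ ∃ x : F, x ^ 3 = 2) :
    ({β : F | ({t : F | t ^ 3 - 3 * β * t ^ 2 - 1 = 0} : Set F).ncard = 2} : Set F).ncard = 0 ∧
    ({β : F | ({t : F | t ^ 3 - 3 * β * t ^ 2 - 1 = 0} : Set F).ncard = 1} : Set F).ncard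
      = ({β : F | quadChar F (1 + 4 * β ^ 3) = -1} : Set F).ncard := by
  rw [← hcard] at hq3
  have h3 : (3 : F) ≠ 0 := three_ne_zero_of_card_mod hq3
  have h20 : (2 : F) ≠ 0 := fun h => h2 ⟨0, by simp [h]⟩
  have h27 : (-27 : F) ≠ 0 := by
    have : (-27 : F) = -3 ^ 3 := by norm_num
    rw [this]
    exact neg_ne_zero.mpr (pow_ne_zero 3 h3)
  have hE (β : F) : 1 + 4 * β ^ 3 ≠ 0 := fun h => h2 ⟨-2 * β, by linear_combination -2 * h⟩
  obtain ⟨w, hw⟩ := exists_sq_eq_neg_three hq3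
  have hw0 : w ≠ 0 := by
    rintro rfl
    apply h3
    linear_combination hw
  have hsq (β : F) : IsSquare (1 + 4 * β ^ 3) ↔ ∃ d : F, d ^ 2 = -27 * (1 + 4 * β ^ 3) := by
    constructor
    · rintro ⟨y, hy⟩
      exact ⟨3 * w * y, by rw [hy]; linear_combination 9 * y ^ 2 * hw⟩
    · rintro ⟨d, hd⟩
      refine ⟨d / (3 * w), ?_⟩
      field_simp
      linear_combination 9 * (1 + 4 * β ^ 3) * hw - hd
  constructor
  · rw [Set.ncard_eq_zero, Set.eq_empty_iff_forall_notMem]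
    intro β hβ
    obtain ⟨a, b, hab, hS⟩ := Set.ncard_eq_two.mp hβ
    have ha : a ^ 3 - 3 * β * a ^ 2 - 1 = 0 := hS.symm.subset (by simp)
    have hb : b ^ 3 - 3 * β * b ^ 2 - 1 = 0 := hS.symm.subset (by simp)
    have hD := cubic_discr hab ha hb
    have hne := mul_ne_zero h27 (hE β)
    have hc := hS.subset (cubic_third_root hab ha hb)
    rw [← hD] at hne
    rcases hc with hc | hc
    · exact hne (by rw [hc]; ring)
    · exact hne (by rw [Set.mem_singleton_iff.mp hc]; ring)
  · congr 1
    ext β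
    simp only [Set.mem_ofPred_eq, quadChar_eq_neg_one_iff, hsq, Set.ncard_eq_one]
    constructor
    · rintro ⟨r, hS⟩ ⟨d, hd⟩
      have hd0 : d ≠ 0 := by
        rintro rfl
        exact mul_ne_zero h27 (hE β) (by simpa using hd.symm)
      have hr : r ^ 3 - 3 * β * r ^ 2 - 1 = 0 := hS.symm.subset (Set.mem_singleton r)
      obtain ⟨s, hsr, hs⟩ := exists_second_root h20 hd0 hd hr
      exact hsr (hS.subset hs)
    · intro hd
      obtain ⟨r, hr⟩ : ∃ r : F, r ^ 3 - 3 * β * r ^ 2 - 1 = 0 := by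
        by_contra! h
        exact hd (exists_discr_eq_sq_of_no_root h)
      refine ⟨r, Set.eq_singleton_iff_unique_mem.mpr ⟨hr, fun s hs => ?_⟩⟩
      by_contra hsr
      exact hd ⟨_, cubic_discr hsr hs hr⟩
end

section
/- Let q ≥ 8 be an even prime power and μ ∈ F_q^* with μ ≠ 1. Then the number of γ ∈ F_q such that the cubic t³ + γt² + μt + γ has exactly one root in F_q equals the number of γ ∈ F_q^* such that Tr( (μ³ + γ⁴)/(γ²(μ+1)²) + 1/(μ+1) ) = 1. -/
section CharTwo

variable {F : Type*} [Field F] [Algebra (ZMod 2) F]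

theorem two_eq_zero_of_algebra_zmod_two : (2 : F) = 0 := by
  have h := map_ofNat (algebraMap (ZMod 2) F) 2
  rw [← h, show (OfNat.ofNat 2 : ZMod 2) = 0 from rfl, map_zero]

variable [Finite F]

theorem trace_sq (x : F) : Algebra.trace (ZMod 2) F (x ^ 2) = Algebra.trace (ZMod 2) F x := by
  have h := Algebra.trace_eq_of_algEquiv
    (FiniteField.frobeniusAlgEquivOfAlgebraic (ZMod 2) F) x
  rwa [FiniteField.coe_frobeniusAlgEquivOfAlgebraic, ZMod.card] at h

theorem trace_sq_add_self (x : F) : Algebra.trace (ZMod 2) F (x ^ 2 + x) = 0 := by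
  rw [map_add, trace_sq, CharTwo.add_self_eq_zero]

/-- Additive Hilbert 90 for the absolute trace in characteristic two. -/
theorem exists_sq_add_self_eq_of_trace_eq_zero {y : F} (hy : Algebra.trace (ZMod 2) F y = 0) :
    ∃ t : F, t ^ 2 + t = y := by
  have h2 : (2 : F) = 0 := two_eq_zero_of_algebra_zmod_two
  let φ : F →ₗ[ZMod 2] F :=
    (FiniteField.frobeniusAlgHom (ZMod 2) F).toLinearMap + LinearMap.id
  have hφ (t : F) : φ t = t ^ 2 + t := by
    simp [φ, ZMod.card]
  have hle : LinearMap.range φ ≤ LinearMap.ker (Algebra.trace (ZMod 2) F) := by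
    rintro _ ⟨t, rfl⟩
    rw [LinearMap.mem_ker, hφ, trace_sq_add_self]
  have hker : Module.finrank (ZMod 2) (LinearMap.ker φ) ≤ 1 := by
    have hspan : LinearMap.ker φ ≤ Submodule.span (ZMod 2) {(1 : F)} := by
      intro t ht
      rw [LinearMap.mem_ker, hφ] at ht
      have ht' : t * (t + 1) = 0 := by linear_combination ht
      rcases mul_eq_zero.mp ht' with h | h
      · rw [h]; exact zero_mem _
      · rw [show t = 1 by linear_combination h - h2]
        exact Submodule.mem_span_singleton_self 1
    exact (Submodule.finrank_mono hspan).trans (finrank_span_singleton one_ne_zero).le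
  have hφrank := φ.finrank_range_add_finrank_ker
  have htr := (Algebra.trace (ZMod 2) F).finrank_range_add_finrank_ker
  rw [LinearMap.range_eq_top.mpr (Algebra.trace_surjective (ZMod 2) F), finrank_top,
    Module.finrank_self] at htr
  have heq := Submodule.eq_of_le_of_finrank_le hle (by omega)
  have hmem : y ∈ LinearMap.range φ := by rwa [heq, LinearMap.mem_ker]
  obtain ⟨t, ht⟩ := hmem
  exact ⟨t, by rw [← hφ, ht]⟩

/-- If `r` is a nonzero root of `x³ + ax + b`, then `a³/b²` and `a/r²` have the same trace. -/
theorem trace_one_add_cube_div_sq {a b r : F} (hb : b ≠ 0) (hr : r ^ 3 + a * r + b = 0) :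
    Algebra.trace (ZMod 2) F (1 + a ^ 3 / b ^ 2) = Algebra.trace (ZMod 2) F (1 + a / r ^ 2) := by
  have h2 : (2 : F) = 0 := two_eq_zero_of_algebra_zmod_two
  have hbr : b = r * (r ^ 2 + a) := by linear_combination hr - (r ^ 3 + a * r) * h2
  have hr0 : r ≠ 0 := by rintro rfl; simp [hbr] at hb
  have hs0 : r ^ 2 + a ≠ 0 := by intro h; simp [hbr, h] at hb
  have key : 1 + a ^ 3 / b ^ 2 =
      1 + a / r ^ 2 + ((a / (r ^ 2 + a)) ^ 2 + a / (r ^ 2 + a)) := by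
    rw [hbr]
    field_simp
    grind
  rw [key, map_add _ _ ((a / (r ^ 2 + a)) ^ 2 + _), trace_sq_add_self, add_zero]

/-- A root `r` of `x³ + ax + b` with `b ≠ 0` is not the only one iff `1 + a/r²` has trace zero. -/
theorem exists_root_ne_iff_trace_eq_zero {a b r : F} (hb : b ≠ 0)
    (hr : r ^ 3 + a * r + b = 0) :
    (∃ s, s ≠ r ∧ s ^ 3 + a * s + b = 0) ↔ Algebra.trace (ZMod 2) F (1 + a / r ^ 2) = 0 := by
  have h2 : (2 : F) = 0 := two_eq_zero_of_algebra_zmod_two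
  have hr0 : r ≠ 0 := by rintro rfl; simp at hr; exact hb hr
  constructor
  · rintro ⟨s, hsr, hs⟩
    have hquad : s ^ 2 + s * r + r ^ 2 + a = 0 := by
      apply mul_left_cancel₀ (sub_ne_zero.mpr hsr)
      linear_combination hs - hr
    have key : 1 + a / r ^ 2 = (s / r) ^ 2 + s / r := by
      field_simp
      linear_combination hquad - (s ^ 2 + s * r) * h2
    rw [key, trace_sq_add_self]
  · intro h
    obtain ⟨t, ht⟩ := exists_sq_add_self_eq_of_trace_eq_zero h
    have ha : a = r ^ 2 * (t ^ 2 + t) - r ^ 2 := by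
      rw [ht]; field_simp; ring
    refine ⟨t * r, fun htr ↦ ?_, ?_⟩
    · have ht1 : t = 1 := by
        apply mul_right_cancel₀ hr0
        rw [htr, one_mul]
      apply hb
      rw [ht1] at ha
      linear_combination hr - r * ha - r ^ 3 * h2
    · subst ha
      linear_combination hr + (t ^ 3 - t) * r ^ 3 * h2

theorem exists_root_of_trace_eq_one {a b : F} (hb : b ≠ 0)
    (h : Algebra.trace (ZMod 2) F (1 + a ^ 3 / b ^ 2) = 1) :
    ∃ r : F, r ^ 3 + a * r + b = 0 := by
  have h2 : (2 : F) = 0 := two_eq_zero_of_algebra_zmod_two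
  let A : Set F := {r | r ≠ 0 ∧ Algebra.trace (ZMod 2) F (1 + a / r ^ 2) = 1}
  let B : Set F := {b | b ≠ 0 ∧ Algebra.trace (ZMod 2) F (1 + a ^ 3 / b ^ 2) = 1}
  let g : F → F := fun r ↦ r ^ 3 + a * r
  have hroot (r : F) : r ^ 3 + a * r + g r = 0 := by
    linear_combination (r ^ 3 + a * r) * h2
  have hg0 {r : F} (hr : r ∈ A) : g r ≠ 0 := by
    intro h0
    have hra : a = r ^ 2 := by
      apply mul_left_cancel₀ hr.1
      linear_combination h0 - r ^ 3 * h2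
    have htr := hr.2
    rw [hra, div_self (pow_ne_zero 2 hr.1), one_add_one_eq_two, h2, map_zero] at htr
    exact zero_ne_one htr
  have hmaps : Set.MapsTo g A B := fun r hr ↦
    ⟨hg0 hr, (trace_one_add_cube_div_sq (hg0 hr) (hroot r)).trans hr.2⟩
  have hinj : Set.InjOn g A := by
    intro r hr s hs hrs
    by_contra hne
    have h0 := (exists_root_ne_iff_trace_eq_zero (hg0 hr) (hroot r)).mp
      ⟨s, Ne.symm hne, by rw [hrs]; exact hroot s⟩
    exact zero_ne_one (h0.symm.trans hr.2)
  have hcard : B.ncard ≤ A.ncard := by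
    rcases eq_or_ne a 0 with rfl | ha
    · simp [A, B]
    · refine Set.ncard_le_ncard_of_injOn (fun b ↦ b / a) ?_ ?_
      · rintro c ⟨hc, hc'⟩
        refine ⟨div_ne_zero hc ha, ?_⟩
        rw [← hc']
        congr 2
        field_simp
      · intro c _ d _ hcd
        exact (div_left_inj' ha).mp hcd
  have himage : g '' A = B := Set.eq_of_subset_of_ncard_le hmaps.image_subset
    (by rwa [hinj.ncard_image])
  obtain ⟨r, -, hr⟩ := himage.ge ⟨hb, h⟩
  exact ⟨r, by rw [← hr]; exact hroot r⟩

/-- A depressed cubic `x³ + ax + b` with `b ≠ 0` over a finite field of characteristic two has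
exactly one root iff `1 + a³/b²` has absolute trace one. -/
theorem ncard_roots_depressed_cubic_eq_one_iff {a b : F} (hb : b ≠ 0) :
    {t : F | t ^ 3 + a * t + b = 0}.ncard = 1 ↔
      Algebra.trace (ZMod 2) F (1 + a ^ 3 / b ^ 2) = 1 := by
  rw [Set.ncard_eq_one]
  constructor
  · rintro ⟨r, hr⟩
    have hroot : r ^ 3 + a * r + b = 0 := by
      have : r ∈ {t : F | t ^ 3 + a * t + b = 0} := by rw [hr]; rfl
      exact this
    rw [trace_one_add_cube_div_sq hb hroot]
    apply Fin.eq_one_of_ne_zero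
    intro h0
    obtain ⟨s, hsr, hs⟩ := (exists_root_ne_iff_trace_eq_zero hb hroot).mpr h0
    exact hsr (hr.le hs)
  · intro h
    obtain ⟨r, hr⟩ := exists_root_of_trace_eq_one hb h
    refine ⟨r, Set.eq_singleton_iff_unique_mem.mpr ⟨hr, fun s hs ↦ ?_⟩⟩
    by_contra hsr
    rw [trace_one_add_cube_div_sq hb hr,
      (exists_root_ne_iff_trace_eq_zero hb hr).mp ⟨s, hsr, hs⟩] at h
    exact zero_ne_one h

theorem ncard_roots_cubic_eq_one_iff {μ γ : F} (hμ1 : μ ≠ 1) (hγ : γ ≠ 0) :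
    {t : F | t ^ 3 + γ * t ^ 2 + μ * t + γ = 0}.ncard = 1 ↔
      Algebra.trace (ZMod 2) F
        ((μ ^ 3 + γ ^ 4) / (γ ^ 2 * (μ + 1) ^ 2) + 1 / (μ + 1)) = 1 := by
  have h2 : (2 : F) = 0 := two_eq_zero_of_algebra_zmod_two
  have hμ : μ + 1 ≠ 0 := fun h ↦ hμ1 (by linear_combination h - h2)
  have himage : {t : F | t ^ 3 + γ * t ^ 2 + μ * t + γ = 0} =
      (· + γ) '' {s : F | s ^ 3 + (γ ^ 2 + μ) * s + γ * (μ + 1) = 0} := by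
    ext t
    simp only [Set.image_add_right, Set.mem_preimage, Set.mem_ofPred_eq]
    grind
  rw [himage, Set.ncard_image_of_injective _ (add_left_injective γ),
    ncard_roots_depressed_cubic_eq_one_iff (mul_ne_zero hγ hμ)]
  have key : 1 + (γ ^ 2 + μ) ^ 3 / (γ * (μ + 1)) ^ 2 =
      (μ ^ 3 + γ ^ 4) / (γ ^ 2 * (μ + 1) ^ 2) + 1 / (μ + 1) +
        (((γ ^ 2 + 1) / (μ + 1)) ^ 2 + (γ ^ 2 + 1) / (μ + 1)) := by
    field_simp
    grind
  rw [key, map_add _ _ (((γ ^ 2 + 1) / (μ + 1)) ^ 2 + _), trace_sq_add_self, add_zero]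

theorem ncard_roots_cubic_zero_ne_one {μ : F} (hμ0 : μ ≠ 0) :
    {t : F | t ^ 3 + 0 * t ^ 2 + μ * t + 0 = 0}.ncard ≠ 1 := by
  have h2 : (2 : F) = 0 := two_eq_zero_of_algebra_zmod_two
  have hchar : CharP F 2 := charP_of_injective_algebraMap' (ZMod 2) 2
  obtain ⟨s, hs⟩ := FiniteField.isSquare_of_char_two (ringChar.eq F 2) μ
  intro h
  obtain ⟨r, hr⟩ := Set.ncard_eq_one.mp h
  have hzero : (0 : F) = r := hr.le (by simp)
  have hsr : s = r := hr.le (by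
    rw [Set.mem_ofPred_eq, hs]
    linear_combination s ^ 3 * h2)
  apply hμ0
  rw [hs, hsr, ← hzero, mul_zero]

end CharTwo


/-- Let `q = 2^n ≥ 8` be an even prime power and `μ ∈ F_q^*`, `μ ≠ 1`.
Then the number of `γ ∈ F_q` such that `t³ + γt² + μt + γ` has exactly one root in `F_q`
equals the number of `γ ∈ F_q^*` with `Tr((μ³ + γ⁴)/(γ²(μ+1)²) + 1/(μ+1)) = 1`, where
`Tr` is the absolute trace `F_q → F_2`. -/
theorem stmt12 (n : ℕ) (hn : 3 ≤ n) (μ : GaloisField 2 n) (hμ0 : μ ≠ 0) (hμ1 : μ ≠ 1) :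
    Set.ncard {γ : GaloisField 2 n |
        ({t : GaloisField 2 n | t ^ 3 + γ * t ^ 2 + μ * t + γ = 0} :
          Set (GaloisField 2 n)).ncard = 1}
      = Set.ncard {γ : GaloisField 2 n | γ ≠ 0 ∧
          Algebra.trace (ZMod 2) (GaloisField 2 n)
            ((μ ^ 3 + γ ^ 4) / (γ ^ 2 * (μ + 1) ^ 2) + 1 / (μ + 1)) = 1} := by
  congr 1
  ext γ
  rcases eq_or_ne γ 0 with rfl | hγ
  · simpa using ncard_roots_cubic_zero_ne_one hμ0
  · simpa only [Set.mem_ofPred_eq, hγ, ne_eq, not_false_eq_true, true_and] using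
      ncard_roots_cubic_eq_one_iff hμ1 hγ
end

section
/- Let q ≥ 5 be an odd prime power with q ≡ ξ (mod 3), ξ ∈ {1, -1}, and let μ ∈ F_q^* with μ ≠ 1 and μ ≠ 1/9. Set Δ̃(μ,c) = c² + 4 + 4μc⁴ - 27μ²c² + 18μc². Then the number of c ∈ F_q^* such that the cubic t³ + ct² - t - μc has exactly one root in F_q equals the number of c ∈ F_q^* with η(-3Δ̃(μ,c)) = -ξ. -/
open scoped Classical

theorem quadChar_eq_quadraticChar {F : Type*} [Field F] [Fintype F] (a : F) :
    quadChar F a = quadraticChar F a := by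
  rw [quadChar, quadraticChar_apply, quadraticCharFun]
  congr

/-- An element of an extension of `F_q` that is fixed by the `q`-power map lies in `F_q`. -/
theorem exists_algebraMap_eq_of_pow_card_eq {F L : Type*} [Field F] [Fintype F] [Field L]
    [Algebra F L] {x : L} (hx : x ^ Fintype.card F = x) : ∃ a : F, algebraMap F L a = x := by
  have hne : (Polynomial.X ^ Fintype.card F - Polynomial.X : Polynomial L) ≠ 0 :=
    FiniteField.X_pow_card_sub_X_ne_zero L Fintype.one_lt_card
  have hsub : Finset.univ.image (algebraMap F L) ⊆
      (Polynomial.X ^ Fintype.card F - Polynomial.X : Polynomial L).roots.toFinset := by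
    intro y hy
    obtain ⟨a, -, rfl⟩ := Finset.mem_image.mp hy
    simp [Polynomial.mem_roots hne, ← map_pow, FiniteField.pow_card]
  have hcard : (Polynomial.X ^ Fintype.card F - Polynomial.X : Polynomial L).roots.toFinset.card ≤
      (Finset.univ.image (algebraMap F L)).card := by
    rw [Finset.card_image_of_injective _ (algebraMap F L).injective, Finset.card_univ]
    refine (Multiset.toFinset_card_le _).trans ((Polynomial.card_roots' _).trans ?_)
    rw [FiniteField.X_pow_card_sub_X_natDegree_eq L Fintype.one_lt_card]
  have hmem : x ∈ (Polynomial.X ^ Fintype.card F - Polynomial.X : Polynomial L).roots.toFinset := by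
    simp [Polynomial.mem_roots hne, hx]
  rw [← Finset.eq_of_subset_of_card_le hsub hcard] at hmem
  obtain ⟨a, -, ha⟩ := Finset.mem_image.mp hmem
  exact ⟨a, ha⟩

/-- A monic cubic over a finite field without roots has square discriminant. -/
theorem isSquare_discr_of_forall_ne_zero {F : Type*} [Field F] [Fintype F] (b c d : F)
    (h : ∀ t : F, t ^ 3 + b * t ^ 2 + c * t + d ≠ 0) : IsSquare (Cubic.discr ⟨1, b, c, d⟩) := by
  let L := AlgebraicClosure F
  let i : F →+* L := algebraMap F L
  have ha : (⟨1, b, c, d⟩ : Cubic F).a ≠ 0 := one_ne_zero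
  obtain ⟨x, y, z, h3⟩ := (Cubic.splits_iff_roots_eq_three (φ := i) ha).mp
    (IsAlgClosed.splits _)
  have hb : i b = -(x + y + z) := by simpa using Cubic.b_eq_three_roots ha h3
  have hc : i c = x * y + x * z + y * z := by simpa using Cubic.c_eq_three_roots ha h3
  have hd : i d = -(x * y * z) := by simpa using Cubic.d_eq_three_roots ha h3
  have hD : i (Cubic.discr ⟨1, b, c, d⟩) = ((x - y) * (x - z) * (y - z)) ^ 2 := by
    simpa using Cubic.discr_eq_prod_three_roots ha h3
  let f : L →ₐ[F] L := FiniteField.frobeniusAlgHom F L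
  have hfixed : ∀ w : L, f w = w → ∃ a : F, i a = w :=
    fun w hw => exists_algebraMap_eq_of_pow_card_eq hw
  have hfi : ∀ a : F, f (i a) = i a := f.commutes
  have hroot : ∀ w : L, (w - x) * (w - y) * (w - z) = 0 → f w ≠ w := by
    intro w hw hf
    obtain ⟨a, rfl⟩ := hfixed w hf
    refine h a (i.injective ?_)
    simp only [map_add, map_mul, map_pow, map_zero, hb, hc, hd]
    linear_combination hw
  have hperm : ∀ w : L, (w - x) * (w - y) * (w - z) = 0 →
      (f w - x) * (f w - y) * (f w - z) = 0 := by
    intro w hw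
    have e : w ^ 3 + i b * w ^ 2 + i c * w + i d = 0 := by
      rw [hb, hc, hd]; linear_combination hw
    have e' := congrArg f e
    simp only [map_add, map_mul, map_pow, map_zero, hfi] at e'
    rw [hb, hc, hd] at e'
    linear_combination e'
  have hsum : f x + f y + f z = x + y + z := by
    have e := hfi b
    rw [hb] at e
    simp only [map_add, map_neg] at e
    linear_combination -e
  have hx := hroot x (by ring)
  have hy := hroot y (by ring)
  have hz := hroot z (by ring)
  have hδ : f ((x - y) * (x - z) * (y - z)) = (x - y) * (x - z) * (y - z) := by
    simp only [map_mul, map_sub]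
    have px := hperm x (by ring)
    have py := hperm y (by ring)
    simp only [mul_eq_zero, sub_eq_zero] at px py
    rcases px with (px | px) | px
    · exact absurd px hx
    · rcases py with (py | py) | py
      · exact absurd (by linear_combination hsum - px - py) hz
      · exact absurd py hy
      · have pz : f z = x := by linear_combination hsum - px - py
        rw [px, py, pz]; ring
    · have hyx : f y = x := by
        rcases py with (py | py) | py
        · exact py
        · exact absurd py hy
        · have pz : f z = x + y - z := by linear_combination hsum - px - py
          have pz' := hperm z (by ring)
          have hxy : f (x - y) = 0 := by rw [map_sub, px, py, sub_self]
          have hxy' : x = y := sub_eq_zero.mp ((map_eq_zero f).mp hxy)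
          rw [pz, ← hxy'] at pz'
          simp only [mul_eq_zero, sub_eq_zero] at pz'
          have hxz : x = z ∨ (2 : L) * (x - z) = 0 := by
            rcases pz' with (e | e) | e
            · left; linear_combination e
            · left; linear_combination e
            · right; linear_combination e
          rcases hxz with e | e
          · exact absurd (px.trans e.symm) hx
          · rw [← hxy'] at pz
            exact absurd (pz.trans (by linear_combination e)) hz
      have pz : f z = y := by linear_combination hsum - px - hyx
      rw [px, hyx, pz]; ring
  obtain ⟨s, hs⟩ := hfixed _ hδ
  refine ⟨s, i.injective ?_⟩
  rw [hD, map_mul, hs, sq]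

/-- Over a finite field of odd characteristic, a monic cubic that is not a cube of a linear
polynomial has exactly one root iff its discriminant is not a square. -/
theorem ncard_roots_eq_one_iff_not_isSquare_discr {F : Type*} [Field F] [Fintype F]
    (h2 : (2 : F) ≠ 0) (b c d : F)
    (htriple : ∀ a : F, ¬ (b = -3 * a ∧ c = 3 * a ^ 2 ∧ d = -a ^ 3)) :
    ({t : F | t ^ 3 + b * t ^ 2 + c * t + d = 0} : Set F).ncard = 1 ↔
      ¬ IsSquare (Cubic.discr ⟨1, b, c, d⟩) := by
  rw [Set.ncard_eq_one]
  constructor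
  · rintro ⟨a, ha⟩ ⟨s, hs⟩
    have huniq : ∀ t : F, t ^ 3 + b * t ^ 2 + c * t + d = 0 → t = a :=
      fun t ht => (Set.ext_iff.mp ha t).mp ht
    have hroot : a ^ 3 + b * a ^ 2 + c * a + d = 0 := (Set.ext_iff.mp ha a).mpr rfl
    have hquad : ∀ t : F, t ^ 2 + (b + a) * t + (c + a * (b + a)) = 0 → t = a :=
      fun t ht => huniq t (by linear_combination (t - a) * ht + hroot)
    have hd : d = -(a ^ 3 + b * a ^ 2 + c * a) := by linear_combination hroot
    have hdouble : a ^ 2 + (b + a) * a + (c + a * (b + a)) = 0 := by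
      by_contra hne
      set u := a ^ 2 + (b + a) * a + (c + a * (b + a)) with hu
      have hw : (s / u) ^ 2 = (b + a) ^ 2 - 4 * (c + a * (b + a)) := by
        rw [div_pow, div_eq_iff (pow_ne_zero 2 hne), sq s, ← hs, hu]
        simp only [Cubic.discr, hd]
        ring
      have hw' : ((-(b + a) + s / u) / 2) ^ 2 + (b + a) * ((-(b + a) + s / u) / 2)
          + (c + a * (b + a)) = 0 := by
        field_simp [h2] at hw ⊢
        linear_combination hw
      have e := hquad _ hw'
      rw [e] at hw'
      exact hne hw'
    have hother : -(b + a) - a = a := hquad _ (by linear_combination hdouble)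
    have hb : b = -3 * a := by linear_combination -hother
    have hc : c = 3 * a ^ 2 := by rw [hb] at hdouble; linear_combination hdouble
    exact htriple a ⟨hb, hc, by rw [hd, hb, hc]; ring⟩
  · intro hns
    obtain ⟨a, ha⟩ : ∃ a : F, a ^ 3 + b * a ^ 2 + c * a + d = 0 := by
      by_contra! h
      exact hns (isSquare_discr_of_forall_ne_zero b c d h)
    refine ⟨a, Set.eq_singleton_iff_unique_mem.mpr ⟨ha, fun t ht => ?_⟩⟩
    by_contra hta
    have ht : t ^ 3 + b * t ^ 2 + c * t + d = 0 := ht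
    have hc : c = -(t ^ 2 + t * a + a ^ 2 + b * (t + a)) := by
      refine mul_left_cancel₀ (sub_ne_zero.mpr hta) ?_
      linear_combination ht - ha
    have hd : d = -(a ^ 3 + b * a ^ 2 + c * a) := by linear_combination ha
    refine hns ⟨(t - a) * (t - (-b - a - t)) * (a - (-b - a - t)), ?_⟩
    simp only [Cubic.discr, hd, hc]
    ring

/-- `-3` is a square in `F_q` exactly when `q ≡ 1 (mod 3)`, in characteristic prime to `6`. -/
theorem isSquare_neg_three_iff {F : Type*} [Field F] [Fintype F] (h2 : (2 : F) ≠ 0)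
    (h3 : (3 : F) ≠ 0) : IsSquare (-3 : F) ↔ Fintype.card F % 3 = 1 := by
  have hq3 : Fintype.card F % 3 ≠ 0 := by
    intro h
    obtain ⟨k, hk⟩ := Nat.dvd_of_mod_eq_zero h
    obtain ⟨p, n, hp, hp', hn⟩ := FiniteField.card' F
    have : 3 ∣ p := Nat.prime_three.dvd_of_dvd_pow (hn ▸ hk ▸ dvd_mul_right 3 k)
    have hp3 := (Nat.prime_dvd_prime_iff_eq Nat.prime_three hp').mp this
    subst hp3
    exact h3 (by exact_mod_cast CharP.cast_eq_zero F 3)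
  constructor
  · rintro ⟨s, hs⟩
    by_contra h1
    have hmod : Fintype.card F = 3 * (Fintype.card F / 3) + 2 := by omega
    set w : F := (-1 + s) / 2 with hw
    have hw2 : w ^ 2 + w + 1 = 0 := by
      rw [hw]; field_simp; linear_combination -hs
    have hw3 : w ^ 3 = 1 := by linear_combination (w - 1) * hw2
    have hwq := FiniteField.pow_card w
    rw [hmod, pow_add, pow_mul, hw3, one_pow, one_mul] at hwq
    have : (3 : F) = 0 := by linear_combination 4 * hw2 - (2 * w + 1) * (hw2 - hwq)
    exact h3 this
  · intro h
    have : Fact (Nat.Prime 3) := ⟨Nat.prime_three⟩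
    have hdvd : 3 ∣ Fintype.card Fˣ := by rw [Fintype.card_units]; omega
    obtain ⟨u, hu⟩ := exists_prime_orderOf_dvd_card 3 hdvd
    have hu3 : (u : F) ^ 3 = 1 := by
      rw [← Units.val_pow_eq_pow_val, ← hu, pow_orderOf_eq_one, Units.val_one]
    have hu1 : (u : F) - 1 ≠ 0 := by
      intro e
      have : u = 1 := Units.ext (by simpa using sub_eq_zero.mp e)
      simp [this] at hu
    have hq : (u : F) ^ 2 + u + 1 = 0 := by
      refine mul_left_cancel₀ hu1 ?_
      linear_combination hu3
    exact ⟨2 * u + 1, by linear_combination -4 * hq⟩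

/-- Let `q ≥ 5` be an odd prime power with `q ≡ ξ (mod 3)`,
`ξ ∈ {1,-1}`, and let `μ ∈ F_q^*` with `μ ≠ 1`, `μ ≠ 1/9`. With
`Δ̃(μ,c) = c² + 4 + 4μc⁴ - 27μ²c² + 18μc²`, the number of `c ∈ F_q^*` such that
`t³ + ct² - t - μc` has exactly one root in `F_q` equals the number of `c ∈ F_q^*`
with `η(-3Δ̃(μ,c)) = -ξ`. -/
theorem stmt15 (q : ℕ) (hq5 : 5 ≤ q) (hodd : Odd q)
    (ξ : ℤ) (hξ : ξ = 1 ∨ ξ = -1) (hmod : (q : ℤ) ≡ ξ [ZMOD 3])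
    (F : Type*) [Field F] [Fintype F] (hcard : Fintype.card F = q)
    (μ : F) (hμ0 : μ ≠ 0) (hμ1 : μ ≠ 1) (hμ9 : μ ≠ 1 / 9) :
    Set.ncard {c : F | c ≠ 0 ∧
        ({t : F | t ^ 3 + c * t ^ 2 - t - μ * c = 0} : Set F).ncard = 1}
      = Set.ncard {c : F | c ≠ 0 ∧
          quadChar F (-3 * (c ^ 2 + 4 + 4 * μ * c ^ 4 - 27 * μ ^ 2 * c ^ 2
            + 18 * μ * c ^ 2)) = -ξ} := by
  subst hcard
  have hq0 : (Fintype.card F : F) = 0 := Nat.cast_card_eq_zero F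
  have h2 : (2 : F) ≠ 0 := by
    intro h
    obtain ⟨k, hk⟩ := hodd
    rw [hk] at hq0
    push_cast at hq0
    exact one_ne_zero (by linear_combination hq0 - k * h : (1 : F) = 0)
  have h3 : (3 : F) ≠ 0 := by
    intro h
    obtain ⟨k, hk⟩ := hmod.dvd
    have hk' : ξ = Fintype.card F + 3 * k := by linarith
    have e : (ξ : F) = 0 := by rw [hk']; push_cast; rw [hq0, h]; ring
    rcases hξ with rfl | rfl <;> simp at e
  have hχ : quadraticChar F (-3) = ξ := by
    have hsq := isSquare_neg_three_iff h2 h3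
    have hmod' : (Fintype.card F : ℤ) % 3 = ξ % 3 := hmod
    rcases hξ with rfl | rfl
    · exact (quadraticChar_one_iff_isSquare (neg_ne_zero.mpr h3)).mpr (hsq.mpr (by omega))
    · exact quadraticChar_neg_one_iff_not_isSquare.mpr (fun h => by have := hsq.mp h; omega)
  congr 1
  ext c
  refine and_congr_right fun hc => ?_
  have hset : {t : F | t ^ 3 + c * t ^ 2 - t - μ * c = 0} =
      {t : F | t ^ 3 + c * t ^ 2 + (-1) * t + -(μ * c) = 0} := by
    ext t
    simp only [Set.mem_ofPred_eq]
    rw [show t ^ 3 + c * t ^ 2 + (-1) * t + -(μ * c) = t ^ 3 + c * t ^ 2 - t - μ * c by ring]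
  have hdiscr : Cubic.discr ⟨1, c, -1, -(μ * c)⟩ =
      c ^ 2 + 4 + 4 * μ * c ^ 4 - 27 * μ ^ 2 * c ^ 2 + 18 * μ * c ^ 2 := by
    simp only [Cubic.discr]; ring
  rw [hset, ncard_roots_eq_one_iff_not_isSquare_discr h2, hdiscr, quadChar_eq_quadraticChar,
    map_mul, hχ, ← quadraticChar_neg_one_iff_not_isSquare]
  · rcases hξ with rfl | rfl <;> constructor <;> intro h <;> linarith
  · rintro a ⟨hb, hc', hd⟩
    have h9 : (9 : F) ≠ 0 := by
      rw [show (9 : F) = 3 * 3 by norm_num]; exact mul_ne_zero h3 h3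
    refine hμ9 ((eq_div_iff h9).mpr (mul_left_cancel₀ hc ?_))
    linear_combination -9 * hd - hb - 3 * a * hc'
end
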